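/- arXiv:2312.12759 — 2 statements merged into one kernel-verified Lean document; each statement's English description precedes it below -/
import Mathlib

section
/- Let $(\Omega,\mathcal{F},(\mathcal{F}_t)_{t\ge 0},\mathbb{P})$ be a filtered probability space, let $V:[0,\infty)\times\Omega\to\mathbb{R}$ be a nonnegative adapted right-continuous process, and let $k>0$, $c>0$. Assume the process $Y_t := e^{kt}V_t - c\,(e^{kt}-1)$ is a right-continuous supermartingale with respect to $(\mathcal{F}_t)$, and $V_0 = s$ a.s. for some constant $0\le s\le c$. Then for every $T\ge 0$, $\mathbb{P}\big[\sup_{0\le t\le T} V_t \ge c\big] \le 1 - \big(1 - \tfrac{s}{c}\big)e^{-kT}$. -/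
open MeasureTheory Set
open scoped NNReal

/-- Truncated form of the maximal inequality for a supermartingale sampled along a monotone
sequence of times. -/
theorem MeasureTheory.Supermartingale.mul_measureReal_add_setIntegral_le
    {Ω ι : Type*} [Preorder ι] {m : MeasurableSpace Ω} {μ : Measure Ω} [IsFiniteMeasure μ]
    {ℱ : Filtration ι m} {f : ι → Ω → ℝ} (hf : Supermartingale f ℱ μ)
    {t : ℕ → ι} (ht : Monotone t) (a : ℝ) (n : ℕ) :
    a * μ.real {ω | ∃ i ≤ n, a ≤ f (t i) ω} +
      ∫ ω in {ω | ∃ i ≤ n, a ≤ f (t i) ω}ᶜ, f (t n) ω ∂μ ≤ ∫ ω, f (t 0) ω ∂μ := by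
  have hlevel (i : ℕ) : MeasurableSet[ℱ (t i)] {ω | a ≤ f (t i) ω} :=
    (hf.stronglyAdapted (t i)).measurable measurableSet_Ici
  have hmeas (n : ℕ) : MeasurableSet[ℱ (t n)] {ω | ∃ i ≤ n, a ≤ f (t i) ω} := by
    have : {ω | ∃ i ≤ n, a ≤ f (t i) ω} = ⋃ i, ⋃ (_ : i ≤ n), {ω | a ≤ f (t i) ω} := by
      ext ω; simp
    rw [this]
    exact MeasurableSet.iUnion fun i => MeasurableSet.iUnion fun hi =>
      ℱ.mono (ht hi) _ (hlevel i)
  induction n with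
  | zero =>
    have hA : MeasurableSet {ω | ∃ i ≤ 0, a ≤ f (t i) ω} := ℱ.le _ _ (hmeas 0)
    rw [← integral_add_compl hA (hf.integrable (t 0))]
    gcongr
    refine setIntegral_ge_of_const_le_real hA (measure_ne_top _ _) ?_
      (hf.integrable (t 0)).integrableOn
    rintro ω ⟨i, hi, h⟩
    obtain rfl : i = 0 := by omega
    exact h
  | succ n ih =>
    set A : Set Ω := {ω | ∃ i ≤ n, a ≤ f (t i) ω} with hAdef
    set B : Set Ω := Aᶜ ∩ {ω | a ≤ f (t (n + 1)) ω} with hBdef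
    have hA : MeasurableSet A := ℱ.le _ _ (hmeas n)
    have hL : MeasurableSet {ω | a ≤ f (t (n + 1)) ω} := ℱ.le _ _ (hlevel (n + 1))
    have hB : MeasurableSet B := hA.compl.inter hL
    have hAB : {ω | ∃ i ≤ n + 1, a ≤ f (t i) ω} = A ∪ B := by
      ext ω
      simp only [hAdef, hBdef, mem_ofPred_eq, mem_union, mem_inter_iff, mem_compl_iff]
      constructor
      · rintro ⟨i, hi, h⟩
        by_cases h' : ∃ i ≤ n, a ≤ f (t i) ω
        · exact Or.inl h'
        · rcases Nat.le_succ_iff.1 hi with hi | rfl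
          · exact absurd ⟨i, hi, h⟩ h'
          · exact Or.inr ⟨h', h⟩
      · rintro (⟨i, hi, h⟩ | ⟨-, h⟩)
        · exact ⟨i, by omega, h⟩
        · exact ⟨n + 1, le_rfl, h⟩
    have hdisj : Disjoint A B := disjoint_compl_right.mono_right inter_subset_left
    have hdrift : ∫ ω in Aᶜ, f (t (n + 1)) ω ∂μ ≤ ∫ ω in Aᶜ, f (t n) ω ∂μ :=
      hf.setIntegral_le (ht n.le_succ) (hmeas n).compl
    have hsplit := integral_inter_add_sdiff (s := Aᶜ) hL
      (hf.integrable (t (n + 1))).integrableOn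
    have hge : a * μ.real B ≤ ∫ ω in B, f (t (n + 1)) ω ∂μ :=
      setIntegral_ge_of_const_le_real hB (measure_ne_top _ _) (fun ω hω => hω.2)
        (hf.integrable _).integrableOn
    have hcompl : (A ∪ B)ᶜ = Aᶜ \ {ω | a ≤ f (t (n + 1)) ω} := by
      ext ω
      simp only [hBdef, mem_compl_iff, mem_union, mem_inter_iff, mem_sdiff]
      tauto
    rw [hAB, measureReal_union hdisj hB, hcompl]
    linarith

/-- **Maximal inequality** for a supermartingale sampled along a monotone sequence of times. -/
theorem MeasureTheory.Supermartingale.mul_measureReal_exists_le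
    {Ω ι : Type*} [Preorder ι] {m : MeasurableSpace Ω} {μ : Measure Ω} [IsFiniteMeasure μ]
    {ℱ : Filtration ι m} {f : ι → Ω → ℝ} (hf : Supermartingale f ℱ μ)
    {t : ℕ → ι} (ht : Monotone t) (a : ℝ) (n : ℕ) (hnonneg : ∀ ω, 0 ≤ f (t n) ω) :
    a * μ.real {ω | ∃ i ≤ n, a ≤ f (t i) ω} ≤ ∫ ω, f (t 0) ω ∂μ :=
  (le_add_of_nonneg_right (integral_nonneg hnonneg)).trans
    (hf.mul_measureReal_add_setIntegral_le ht a n)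

/-- The dyadic times of `[0, T]` detect membership of a right-continuous path in an open set. -/
theorem exists_dyadic_mem_of_continuousWithinAt {E : Type*} [TopologicalSpace E]
    {v : ℝ≥0 → E} {t T : ℝ≥0} (hv : ContinuousWithinAt v (Ici t) t) (htT : t ≤ T)
    {U : Set E} (hU : U ∈ nhds (v t)) :
    ∃ N i : ℕ, i ≤ 2 ^ N ∧ v (T * (i / 2 ^ N)) ∈ U := by
  rcases eq_or_ne T 0 with rfl | hT
  · obtain rfl : t = 0 := le_antisymm htT zero_le
    exact ⟨0, 0, by simp, by simpa using mem_of_mem_nhds hU⟩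
  have hpow : Filter.Tendsto (fun N : ℕ => (2 : ℝ) ^ N) Filter.atTop Filter.atTop :=
    tendsto_pow_atTop_atTop_of_one_lt one_lt_two
  have hlim : Filter.Tendsto (fun N : ℕ => T * ((⌈t / T * 2 ^ N⌉₊ : ℝ≥0) / 2 ^ N))
      Filter.atTop (nhds t) := by
    have h : Filter.Tendsto (fun N : ℕ => (⌈t / T * 2 ^ N⌉₊ : ℝ≥0) / 2 ^ N)
        Filter.atTop (nhds (t / T)) := by
      rw [← NNReal.tendsto_coe]
      refine ((tendsto_nat_ceil_mul_div_atTop (t / T).coe_nonneg).comp hpow).congr fun N => ?_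
      have hceil : ⌈((t / T : ℝ≥0) : ℝ) * 2 ^ N⌉₊ = ⌈t / T * 2 ^ N⌉₊ :=
        eq_of_forall_ge_iff fun j => by
          rw [Nat.ceil_le, Nat.ceil_le, ← NNReal.coe_le_coe]
          push_cast
          rfl
      simp only [Function.comp_apply, hceil]
      push_cast
      rfl
    simpa only [mul_div_cancel₀ _ hT] using h.const_mul T
  have hge (N : ℕ) : t ≤ T * ((⌈t / T * 2 ^ N⌉₊ : ℝ≥0) / 2 ^ N) := by
    calc t = T * (t / T * 2 ^ N / 2 ^ N) := by field_simp
      _ ≤ _ := by gcongr; exact Nat.le_ceil _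
  obtain ⟨N, hN⟩ := ((hv.tendsto.comp (tendsto_nhdsWithin_iff.2
    ⟨hlim, Filter.Eventually.of_forall hge⟩)).eventually hU).exists
  refine ⟨N, _, ?_, hN⟩
  rw [Nat.ceil_le]
  push_cast
  exact mul_le_of_le_one_left zero_le (div_le_one_of_le₀ htT zero_le)

/-- Exponential-in-time hitting bound (Kushner's Theorem 3.1): if `V` is a
nonnegative adapted right-continuous process, `V 0 = s` a.s. with `0 ≤ s ≤ c`,
and `Y_t = e^{kt} V_t - c (e^{kt} - 1)` is a right-continuous supermartingale,
then for every `T ≥ 0`,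
`ℙ[sup_{0 ≤ t ≤ T} V_t ≥ c] ≤ 1 - (1 - s/c) e^{-kT}`. -/
theorem szcbf_exponential_hitting_bound
    {Ω : Type*} {m : MeasurableSpace Ω} (ℙ : Measure Ω) [IsProbabilityMeasure ℙ]
    (ℱ : Filtration ℝ≥0 m) (V : ℝ≥0 → Ω → ℝ)
    (hadapted : Adapted ℱ V)
    (hnonneg : ∀ t ω, 0 ≤ V t ω)
    (hrcV : ∀ ω t, ContinuousWithinAt (fun s => V s ω) (Set.Ici t) t)
    (k c : ℝ) (hk : 0 < k) (hc : 0 < c)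
    (hsuper : Supermartingale
      (fun (t : ℝ≥0) ω => Real.exp (k * t) * V t ω - c * (Real.exp (k * t) - 1)) ℱ ℙ)
    (hrcY : ∀ ω t, ContinuousWithinAt
      (fun s : ℝ≥0 => Real.exp (k * s) * V s ω - c * (Real.exp (k * s) - 1))
      (Set.Ici t) t)
    (s : ℝ) (hs0 : 0 ≤ s) (hsc : s ≤ c)
    (hV0 : ∀ᵐ ω ∂ℙ, V 0 ω = s) :
    ∀ T : ℝ≥0,
      (ℙ {ω | (c : EReal) ≤ ⨆ t : Set.Iic T, ((V t.1 ω : ℝ) : EReal)}).toReal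
        ≤ 1 - (1 - s / c) * Real.exp (-(k * T)) := by
  intro T
  set M : ℝ := Real.exp (k * T) with hM
  have hMpos : 0 < M := Real.exp_pos _
  have hexp {t : ℝ≥0} (ht : t ≤ T) : Real.exp (k * t) ≤ M :=
    Real.exp_le_exp.2 (mul_le_mul_of_nonneg_left (NNReal.coe_le_coe.2 ht) hk.le)
  have hZ := hsuper.add (martingale_const ℱ ℙ (c * (M - 1))).supermartingale
  set Z : ℝ≥0 → Ω → ℝ := (fun (t : ℝ≥0) ω =>
    Real.exp (k * t) * V t ω - c * (Real.exp (k * t) - 1)) + fun _ _ => c * (M - 1) with hZdef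
  have hZapp (t : ℝ≥0) (ω : Ω) :
      Z t ω = Real.exp (k * t) * V t ω + c * (M - Real.exp (k * t)) := by
    simp only [hZdef, Pi.add_apply]; ring
  have hZ0 : ∫ ω, Z 0 ω ∂ℙ = s + c * (M - 1) := by
    have : Z 0 =ᵐ[ℙ] fun _ => s + c * (M - 1) := by
      filter_upwards [hV0] with ω hω
      simp [hZapp, hω]
    rw [integral_congr_ae this]
    simp
  set S : Set Ω := {ω | (c : EReal) ≤ ⨆ t : Set.Iic T, ((V t.1 ω : ℝ) : EReal)} with hS
  have key : ∀ l ∈ Ioo 0 c, l * M * ℙ.real S ≤ s + c * (M - 1) := by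
    intro l hl
    let E : ℕ → Set Ω := fun N => {ω | ∃ i : ℕ, i ≤ 2 ^ N ∧ l * M ≤ Z (T * (i / 2 ^ N)) ω}
    have hE (N : ℕ) : l * M * ℙ.real (E N) ≤ s + c * (M - 1) := by
      have hmono : Monotone fun i : ℕ => T * ((i : ℝ≥0) / 2 ^ N) := by
        intro i j hij
        dsimp only
        gcongr
      have h := hZ.mul_measureReal_exists_le hmono (l * M) (2 ^ N) (fun ω => by
        have hT : T * (((2 ^ N : ℕ) : ℝ≥0) / 2 ^ N) = T := by push_cast; field_simp
        rw [hT, hZapp, ← hM, sub_self, mul_zero, add_zero]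
        exact mul_nonneg hMpos.le (hnonneg _ _))
      simpa [hZ0] using h
    have hEmono : Monotone E := by
      refine monotone_nat_of_le_succ fun N ω => ?_
      rintro ⟨i, hi, h⟩
      refine ⟨2 * i, by rw [pow_succ]; omega, ?_⟩
      have : ((2 * i : ℕ) : ℝ≥0) / 2 ^ (N + 1) = i / 2 ^ N := by
        push_cast; rw [pow_succ]; field_simp
      rwa [this]
    have hSE : S ⊆ ⋃ N, E N := by
      intro ω hω
      obtain ⟨⟨t, htT⟩, ht⟩ := lt_iSup_iff.1
        ((EReal.coe_lt_coe_iff.2 hl.2).trans_le hω)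
      obtain ⟨N, i, hi, hlt⟩ := exists_dyadic_mem_of_continuousWithinAt (hrcV ω t) htT
        (Ioi_mem_nhds (EReal.coe_lt_coe_iff.1 ht))
      refine mem_iUnion.2 ⟨N, i, hi, ?_⟩
      have hle : T * ((i : ℝ≥0) / 2 ^ N) ≤ T :=
        mul_le_of_le_one_right zero_le (div_le_one_of_le₀ (mod_cast hi) zero_le)
      rw [hZapp]
      have h1 := hexp hle
      have h2 := mul_le_mul_of_nonneg_left (le_of_lt hlt)
        (Real.exp_pos (k * (T * ((i : ℝ≥0) / 2 ^ N) : ℝ≥0))).le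
      have h3 := mul_le_mul_of_nonneg_right hl.2.le (sub_nonneg.2 h1)
      linarith
    have hlM : 0 < l * M := mul_pos hl.1 hMpos
    have hbound : ℙ.real (⋃ N, E N) ≤ (s + c * (M - 1)) / (l * M) :=
      le_of_tendsto ((ENNReal.tendsto_toReal (measure_ne_top _ _)).comp
          (tendsto_measure_iUnion_atTop hEmono))
        (Filter.Eventually.of_forall fun N => (le_div_iff₀' hlM).2 (hE N))
    exact (le_div_iff₀' hlM).1 ((measureReal_mono hSE).trans hbound)
  have hlim : c * M * ℙ.real S ≤ s + c * (M - 1) := by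
    refine le_of_tendsto (f := fun l => l * M * ℙ.real S) (x := nhdsWithin c (Iio c)) ?_
      (Filter.mem_of_superset (Ioo_mem_nhdsLT hc) key)
    exact ((by fun_prop : Continuous fun l : ℝ => l * M * ℙ.real S).tendsto c).mono_left
      nhdsWithin_le_nhds
  change ℙ.real S ≤ _
  rw [Real.exp_neg, ← hM]
  have hrw : 1 - (1 - s / c) * M⁻¹ = (s + c * (M - 1)) / (c * M) := by
    field_simp
    ring
  rw [hrw]
  exact (le_div_iff₀' (mul_pos hc hMpos)).2 hlim
end

section
/- (Worst-case probabilistic quantification for SZCBFs, Proposition 2.) Let $(\Omega,\mathcal{F},(\mathcal{F}_t)_{t\ge 0},\mathbb{P})$ be a filtered probability space, let $X:[0,\infty)\times\Omega\to\mathbb{R}^n$ be an adapted process, let $h:\mathbb{R}^n\to\mathbb{R}$ be measurable, and let $c>0$, $k>0$. Assume: (i) $h(X_t(\omega))\le c$ for all $t\ge 0$ and all $\omega$; (ii) the process $Z_t := e^{kt}\big(c - h(X_t)\big) - c\,(e^{kt}-1)$ is a right-continuous supermartingale with respect to $(\mathcal{F}_t)$; (iii) there is $\xi\in\mathbb{R}^n$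 with $0<h(\xi)\le c$ and $X_0=\xi$ a.s. Then for every $T\ge 0$, $\mathbb{P}\big[h(X_t)>0 \text{ for all } t\in[0,T]\big] \ge \big(\tfrac{h(\xi)}{c}\big)e^{-kT}$. -/
open MeasureTheory Set
open scoped NNReal

/-- Localized maximal inequality for a supermartingale over finitely many times. -/
theorem MeasureTheory.Supermartingale.mul_measureReal_inter_exists_mem_finset_le
    {Ω ι : Type*} {m : MeasurableSpace Ω} {μ : Measure Ω} [IsFiniteMeasure μ] [LinearOrder ι]
    {ℱ : Filtration ι m} {f : ι → Ω → ℝ} (hf : Supermartingale f ℱ μ) (r : ℝ) (s : Finset ι)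
    (hs : ∀ t ∈ s, 0 ≤ f t) {i : ι} (hi : 0 ≤ f i) (his : ∀ t ∈ s, i ≤ t)
    {A : Set Ω} (hA : MeasurableSet[ℱ i] A) :
    r * μ.real (A ∩ {ω | ∃ t ∈ s, r ≤ f t ω}) ≤ ∫ ω in A, f i ω ∂μ := by
  induction s using Finset.induction_on_min generalizing i A with
  | empty => simpa using integral_nonneg hi
  | insert a s has ih =>
    have hia : i ≤ a := his a (Finset.mem_insert_self a s)
    have hAa : MeasurableSet[ℱ a] A := ℱ.mono hia _ hA
    have hB : MeasurableSet[ℱ a] {ω | r ≤ f a ω} :=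
      (hf.1 a).measurable measurableSet_Ici
    have hBm : MeasurableSet {ω | r ≤ f a ω} := ℱ.le a _ hB
    have hAm : MeasurableSet A := ℱ.le a _ hAa
    have hlt := ih (fun t ht => hs t (Finset.mem_insert_of_mem ht))
      (hs a (Finset.mem_insert_self a s)) (fun t ht => (has t ht).le) (hAa.diff hB)
    have hge : r * μ.real (A ∩ {ω | r ≤ f a ω}) ≤ ∫ ω in A ∩ {ω | r ≤ f a ω}, f a ω ∂μ := by
      rw [mul_comm, ← smul_eq_mul, ← setIntegral_const]
      exact setIntegral_mono_on (integrable_const r).integrableOn (hf.2.2 a).integrableOn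
        (hAm.inter hBm) fun ω hω => hω.2
    have hsplit : μ.real (A ∩ {ω | ∃ t ∈ insert a s, r ≤ f t ω})
        = μ.real (A ∩ {ω | r ≤ f a ω})
          + μ.real ((A \ {ω | r ≤ f a ω}) ∩ {ω | ∃ t ∈ s, r ≤ f t ω}) := by
      rw [← measureReal_inter_add_sdiff (s := A ∩ {ω | ∃ t ∈ insert a s, r ≤ f t ω}) hBm]
      congr 2
      · ext ω
        simp only [mem_inter_iff, mem_ofPred_eq, Finset.mem_insert]
        grind
      · ext ω
        simp only [mem_inter_iff, mem_sdiff, mem_ofPred_eq, Finset.mem_insert]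
        grind
    calc r * μ.real (A ∩ {ω | ∃ t ∈ insert a s, r ≤ f t ω})
        ≤ (∫ ω in A ∩ {ω | r ≤ f a ω}, f a ω ∂μ) + ∫ ω in A \ {ω | r ≤ f a ω}, f a ω ∂μ := by
          rw [hsplit, mul_add]
          exact add_le_add hge hlt
      _ = ∫ ω in A, f a ω ∂μ := integral_inter_add_sdiff hBm (hf.2.2 a).integrableOn
      _ ≤ ∫ ω in A, f i ω ∂μ := hf.setIntegral_le hia hA

/-- Maximal inequality for a supermartingale over countably many times. -/
theorem MeasureTheory.Supermartingale.mul_measureReal_exists_mem_countable_le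
    {Ω ι : Type*} {m : MeasurableSpace Ω} {μ : Measure Ω} [IsFiniteMeasure μ] [LinearOrder ι]
    {ℱ : Filtration ι m} {f : ι → Ω → ℝ} (hf : Supermartingale f ℱ μ) (r : ℝ) {S : Set ι}
    (hS : S.Countable) (hnonneg : ∀ t ∈ S, 0 ≤ f t) {i : ι} (hi : 0 ≤ f i)
    (hiS : ∀ t ∈ S, i ≤ t) :
    r * μ.real {ω | ∃ t ∈ S, r ≤ f t ω} ≤ ∫ ω, f i ω ∂μ := by
  have : Countable S := hS
  let E : Finset S → Set Ω := fun s => {ω | ∃ t ∈ s, r ≤ f t ω}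
  have hE : Monotone E := fun s s' hss' ω ⟨t, ht, h⟩ => ⟨t, hss' ht, h⟩
  have hunion : {ω | ∃ t ∈ S, r ≤ f t ω} = ⋃ s, E s := by
    ext ω
    simp only [E, mem_ofPred_eq, mem_iUnion]
    exact ⟨fun ⟨t, ht, h⟩ => ⟨{⟨t, ht⟩}, ⟨t, ht⟩, Finset.mem_singleton_self _, h⟩,
      fun ⟨_, t, _, h⟩ => ⟨t, t.2, h⟩⟩
  have hlim : Filter.Tendsto (fun s => r * μ.real (E s)) Filter.atTop
      (nhds (r * μ.real (⋃ s, E s))) :=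
    ((ENNReal.tendsto_toReal (measure_ne_top μ _)).comp
      (tendsto_measure_iUnion_atTop hE)).const_mul r
  rw [hunion]
  refine le_of_tendsto' hlim fun s => ?_
  have := hf.mul_measureReal_inter_exists_mem_finset_le r (s.map (Function.Embedding.subtype _))
    (by simpa using fun t ht _ => hnonneg t ht) hi (by simpa using fun t ht _ => hiS t ht)
    (A := univ) MeasurableSet.univ
  simpa [E] using this

/-- Ville's maximal inequality for a right-continuous supermartingale that is nonnegative on a
bounded time interval. -/
theorem MeasureTheory.Supermartingale.mul_measureReal_exists_le_le
    {Ω : Type*} {m : MeasurableSpace Ω} {μ : Measure Ω} [IsFiniteMeasure μ]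
    {ℱ : Filtration ℝ≥0 m} {f : ℝ≥0 → Ω → ℝ} (hf : Supermartingale f ℱ μ)
    (hrc : ∀ ω t, ContinuousWithinAt (fun s => f s ω) (Ici t) t) (T : ℝ≥0)
    (hnonneg : ∀ t ≤ T, 0 ≤ f t) (r : ℝ) :
    r * μ.real {ω | ∃ t ≤ T, r ≤ f t ω} ≤ ∫ ω, f 0 ω ∂μ := by
  obtain ⟨D, hDc, hD⟩ := TopologicalSpace.exists_countable_dense ℝ≥0
  let S : Set ℝ≥0 := insert T (D ∩ Iic T)
  have hST : ∀ t ∈ S, t ≤ T := by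
    rintro t (rfl | ht)
    exacts [le_rfl, ht.2]
  have hSc : S.Countable := (hDc.mono inter_subset_left).insert T
  have hbelow : ∀ q < r, q * μ.real {ω | ∃ t ≤ T, r ≤ f t ω} ≤ ∫ ω, f 0 ω ∂μ := by
    intro q hq
    have hsub : {ω | ∃ t ≤ T, r ≤ f t ω} ⊆ {ω | ∃ t ∈ S, q ≤ f t ω} := by
      rintro ω ⟨t, htT, ht⟩
      rcases htT.eq_or_lt with rfl | htT
      · exact ⟨t, mem_insert _ _, hq.le.trans ht⟩
      · have hev : ∀ᶠ s in nhdsWithin t (Ioi t), q < f s ω :=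
          ((hrc ω t).mono Ioi_subset_Ici_self).eventually (lt_mem_nhds (hq.trans_le ht))
        obtain ⟨u, htu, hu⟩ := (mem_nhdsGT_iff_exists_Ioo_subset' htT).1 hev
        obtain ⟨s, hsD, hs⟩ := hD.exists_between (lt_min htu htT)
        exact ⟨s, mem_insert_of_mem _ ⟨hsD, hs.2.le.trans (min_le_right _ _)⟩,
          (hu ⟨hs.1, hs.2.trans_le (min_le_left _ _)⟩).le⟩
    rcases le_total q 0 with hq0 | hq0
    · exact (mul_nonpos_of_nonpos_of_nonneg hq0 measureReal_nonneg).trans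
        (integral_nonneg (hnonneg 0 zero_le))
    · exact (mul_le_mul_of_nonneg_left (measureReal_mono hsub) hq0).trans
        (hf.mul_measureReal_exists_mem_countable_le q hSc (fun t ht => hnonneg t (hST t ht))
          (hnonneg 0 zero_le) fun _ _ => zero_le)
  have hlim : Filter.Tendsto (fun q => q * μ.real {ω | ∃ t ≤ T, r ≤ f t ω})
      (nhdsWithin r (Iio r)) (nhds (r * μ.real {ω | ∃ t ≤ T, r ≤ f t ω})) :=
    (Filter.tendsto_id.mono_left nhdsWithin_le_nhds).mul_const _
  exact le_of_tendsto hlim (eventually_mem_nhdsWithin.mono hbelow)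

/-- Worst-case probabilistic quantification for stochastic zeroing control barrier
functions (Proposition 2): if `h(X_t) ≤ c`, the process
`Z_t = e^{kt}(c - h(X_t)) - c(e^{kt} - 1)` is a right-continuous supermartingale,
and `X_0 = ξ` a.s. with `0 < h ξ ≤ c`, then for every `T ≥ 0`,
`ℙ[h(X_t) > 0 for all t ∈ [0,T]] ≥ (h ξ / c) e^{-kT}`. -/
theorem szcbf_worst_case_safety_probability
    {Ω : Type*} {m : MeasurableSpace Ω} (ℙ : Measure Ω) [IsProbabilityMeasure ℙ]
    {n : ℕ} (ℱ : Filtration ℝ≥0 m)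
    (X : ℝ≥0 → Ω → EuclideanSpace ℝ (Fin n))
    (hadapted : Adapted ℱ X)
    (h : EuclideanSpace ℝ (Fin n) → ℝ) (hmeas : Measurable h)
    (c k : ℝ) (hc : 0 < c) (hk : 0 < k)
    (hbound : ∀ t ω, h (X t ω) ≤ c)
    (hsuper : Supermartingale
      (fun (t : ℝ≥0) ω => Real.exp (k * t) * (c - h (X t ω)) - c * (Real.exp (k * t) - 1))
      ℱ ℙ)
    (hrc : ∀ ω t, ContinuousWithinAt
      (fun s : ℝ≥0 => Real.exp (k * s) * (c - h (X s ω)) - c * (Real.exp (k * s) - 1))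
      (Set.Ici t) t)
    (ξ : EuclideanSpace ℝ (Fin n)) (hξpos : 0 < h ξ) (hξc : h ξ ≤ c)
    (hX0 : ∀ᵐ ω ∂ℙ, X 0 ω = ξ) :
    ∀ T : ℝ≥0,
      (h ξ / c) * Real.exp (-(k * T))
        ≤ (ℙ {ω | ∀ t ≤ T, 0 < h (X t ω)}).toReal := by
  intro T
  set r : ℝ := c * Real.exp (k * T) with hr
  have hrpos : 0 < r := by positivity
  let W : ℝ≥0 → Ω → ℝ := fun t ω =>
    (Real.exp (k * t) * (c - h (X t ω)) - c * (Real.exp (k * t) - 1)) + (r - c)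
  have hW : ∀ t ω, W t ω = r - Real.exp (k * t) * h (X t ω) := fun t ω => by
    simp only [W]
    ring
  have hWsuper : Supermartingale W ℱ ℙ :=
    hsuper.add (martingale_const ℱ ℙ (r - c)).supermartingale
  have hWrc : ∀ ω t, ContinuousWithinAt (fun s => W s ω) (Ici t) t := fun ω t =>
    (hrc ω t).add continuousWithinAt_const
  have hWnonneg : ∀ t ≤ T, 0 ≤ W t := by
    intro t ht ω
    have hexp : Real.exp (k * t) ≤ Real.exp (k * T) := by gcongr
    have h₁ : Real.exp (k * t) * h (X t ω) ≤ Real.exp (k * t) * c :=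
      mul_le_mul_of_nonneg_left (hbound t ω) (Real.exp_pos _).le
    have h₂ : Real.exp (k * t) * c ≤ Real.exp (k * T) * c :=
      mul_le_mul_of_nonneg_right hexp hc.le
    rw [hW, hr, Pi.zero_apply]
    linarith
  have hW0 : ∫ ω, W 0 ω ∂ℙ = r - h ξ := by
    have hae : W 0 =ᵐ[ℙ] fun _ => r - h ξ := by
      filter_upwards [hX0] with ω hω
      simp [hW, hω]
    simp [integral_congr_ae hae]
  have hmax := hWsuper.mul_measureReal_exists_le_le hWrc T hWnonneg r
  have hcompl : {ω | ∃ t ≤ T, r ≤ W t ω} = {ω | ∀ t ≤ T, 0 < h (X t ω)}ᶜ := by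
    ext ω
    simp [hW, mul_nonpos_iff_pos_imp_nonpos, Real.exp_pos, Real.exp_nonneg]
  rw [hW0, hcompl] at hmax
  have htotal : 1 ≤ ℙ.real {ω | ∀ t ≤ T, 0 < h (X t ω)}
      + ℙ.real {ω | ∀ t ≤ T, 0 < h (X t ω)}ᶜ := by
    simpa using measureReal_union_le (μ := ℙ) {ω | ∀ t ≤ T, 0 < h (X t ω)}
      {ω | ∀ t ≤ T, 0 < h (X t ω)}ᶜ
  have hlhs : h ξ / c * Real.exp (-(k * T)) = h ξ / r := by
    rw [hr, Real.exp_neg]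
    field_simp
  rw [hlhs, div_le_iff₀ hrpos]
  change h ξ ≤ ℙ.real {ω | ∀ t ≤ T, 0 < h (X t ω)} * r
  nlinarith
end
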